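/- In a two-agent market with two trades that share the same buyer and the same seller, where both agents have fully-substitutable demands, no cycle of the best response dynamic contains any of the following three-column fragments (initiated by either agent, where * denotes either A or R, rows correspond to the two trades): (A,A,R over A,R,*), (R,A,A over R,R,*), (A,A,R over *,A,R), (R,R,A over A,R,A), (R,A,R over R,R,A), nor any of these fragments with the two rows swapped. -/

import Mathlib

open Finset

/-- A trading market: a set `I` of agents, a set `Ω` of bilateral trades, each with a
buyer and a distinct seller, integer-valued valuations over bundles of trades, and a
(unique, tie-broken) demanded bundle at every price vector. -/
structure Market (I Ω : Type) [DecidableEq I] where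
  buyer : Ω → I
  seller : Ω → I
  buyer_ne_seller : ∀ ω, buyer ω ≠ seller ω
  v : I → Finset Ω → ℤ
  demand : I → (Ω → ℤ) → Finset Ω
  demand_involves : ∀ i p, ∀ ω ∈ demand i p, buyer ω = i ∨ seller ω = i
  demand_max : ∀ (i : I) (p : Ω → ℤ) (Ψ : Finset Ω),
    (∀ ω ∈ Ψ, buyer ω = i ∨ seller ω = i) →
    v i Ψ - ∑ ω ∈ Ψ, (if buyer ω = i then (1 : ℤ) else if seller ω = i then -1 else 0) * p ω ≤
      v i (demand i p) -
        ∑ ω ∈ demand i p,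
          (if buyer ω = i then (1 : ℤ) else if seller ω = i then -1 else 0) * p ω

/-- A state of the market dynamic: the set of unsatisfied agents and the current offers
`offers i ω` of agent `i` for trade `ω`. -/
structure MState (I Ω : Type) where
  unsat : Finset I
  offers : I → Ω → ℤ

namespace Market

variable {I Ω : Type} [Fintype I] [DecidableEq I] [Fintype Ω] [DecidableEq Ω]

/-- The sign `χ^i_ω`: `1` if `i` buys `ω`, `-1` if `i` sells `ω`, `0` otherwise. -/
def chi (M : Market I Ω) (i : I) (ω : Ω) : ℤ :=
  if M.buyer ω = i then 1 else if M.seller ω = i then -1 else 0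

/-- Quasilinear utility of agent `i` for bundle `Ψ` at prices `p`. -/
def utility (M : Market I Ω) (i : I) (Ψ : Finset Ω) (p : Ω → ℤ) : ℤ :=
  M.v i Ψ - ∑ ω ∈ Ψ, M.chi i ω * p ω

/-- The valuation of the empty bundle is `0`. -/
def Normalized (M : Market I Ω) : Prop := ∀ i : I, M.v i (∅ : Finset Ω) = 0

/-- The prices facing agent `i`: the counterpart's offer `σ^{-i}_ω` for each trade `ω`. -/
def price (M : Market I Ω) (σ : I → Ω → ℤ) (i : I) (ω : Ω) : ℤ :=
  if M.buyer ω = i then σ (M.seller ω) ω else σ (M.buyer ω) ω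

/-- The best response (with step size `ε = 1`) of agent `i` given current offers `σ`:
she matches the counterpart's offer on the trades she demands, and moves off by `1`
(in her favourable direction) otherwise.  Offers of other agents are unchanged. -/
def bestResponse (M : Market I Ω) (σ : I → Ω → ℤ) (i : I) : I → Ω → ℤ := fun j ω =>
  if j = i ∧ (M.buyer ω = i ∨ M.seller ω = i) then
    (if ω ∈ M.demand i (M.price σ i) then M.price σ i ω
     else M.price σ i ω - M.chi i ω)
  else σ j ω

/-- One step of the market dynamic: agent `i` best responds, becomes satisfied, and all
counterparts facing a modified offer become unsatisfied. -/
def mstep (M : Market I Ω) (s : MState I Ω) (i : I) : MState I Ω :=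
  { unsat := (s.unsat.erase i) ∪ (Finset.univ.filter fun j =>
      j ≠ i ∧ ∃ ω : Ω,
        ((M.buyer ω = i ∧ M.seller ω = j) ∨ (M.buyer ω = j ∧ M.seller ω = i)) ∧
        M.bestResponse s.offers i i ω ≠ s.offers i ω),
    offers := M.bestResponse s.offers i }

/-- Running the dynamic along a finite sequence of best-responding agents. -/
def mrun (M : Market I Ω) : MState I Ω → List I → MState I Ω
  | s, [] => s
  | s, i :: L => M.mrun (M.mstep s i) L

/-- A best response sequence of the dynamic is valid if every selected agent is
unsatisfied when selected. -/
def ValidSeq (M : Market I Ω) : MState I Ω → List I → Prop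
  | _, [] => True
  | s, i :: L => i ∈ s.unsat ∧ M.ValidSeq (M.mstep s i) L

/-- A (valid) best response sequence after which the market dynamic terminates, i.e.,
all agents are satisfied. -/
def TerminatingSeq (M : Market I Ω) (s : MState I Ω) (L : List I) : Prop :=
  M.ValidSeq s L ∧ (M.mrun s L).unsat = ∅

/-- Full substitutability of the demand of agent `i` (Hatfield et al.). -/
def FullySubstitutable (M : Market I Ω) (i : I) : Prop :=
  ∀ p p' : Ω → ℤ,
    (((∀ ω, M.seller ω = i → p ω = p' ω) ∧ (∀ ω, M.buyer ω = i → p' ω ≤ p ω)) →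
      ((∀ ω ∈ M.demand i p, M.seller ω = i → ω ∈ M.demand i p') ∧
       (∀ ω ∈ M.demand i p', M.buyer ω = i → p ω = p' ω → ω ∈ M.demand i p))) ∧
    (((∀ ω, M.buyer ω = i → p ω = p' ω) ∧ (∀ ω, M.seller ω = i → p ω ≤ p' ω)) →
      ((∀ ω ∈ M.demand i p, M.buyer ω = i → ω ∈ M.demand i p') ∧
       (∀ ω ∈ M.demand i p', M.seller ω = i → p ω = p' ω → ω ∈ M.demand i p)))

/-- A market with fully substitutable agents. -/
def FSM (M : Market I Ω) : Prop := ∀ i : I, M.FullySubstitutable i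

end Market

namespace Market

variable {Ω : Type} [Fintype Ω] [DecidableEq Ω]

/-- The alternating best response dynamic of a two-agent market, starting with agent `a`:
`altRun M s a n` is the state after `n` best responses. -/
def altRun (M : Market Bool Ω) : MState Bool Ω → Bool → ℕ → MState Bool Ω
  | s, _, 0 => s
  | s, a, n + 1 => M.altRun (M.mstep s a) (!a) n

/-- The alternating best response dynamic terminates (all agents become satisfied). -/
def AltConverges (M : Market Bool Ω) (s : MState Bool Ω) (a : Bool) : Prop :=
  ∃ n : ℕ, (M.altRun s a n).unsat = ∅

end Market

/-- The agent performing the `n`-th best response (0-indexed) of the alternating dynamic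
started by agent `a`. -/
def altAgent (a : Bool) (n : ℕ) : Bool := if n % 2 = 0 then a else !a

namespace Market

variable {Ω : Type} [Fintype Ω] [DecidableEq Ω]

/-- The accept/reject column entries of the alternating best response sequence:
`col M s a n ω = true` means the `n`-th best response accepts (demands) trade `ω`
("A"), and `false` means it rejects it ("R"). -/
def col (M : Market Bool Ω) (s : MState Bool Ω) (a : Bool) (n : ℕ) (ω : Ω) : Bool :=
  decide (ω ∈ M.demand (altAgent a n) (M.price (M.altRun s a n).offers (altAgent a n)))

end Market

/-- An integer sequence which is nonincreasing and bounded below is eventually constant. -/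
theorem exists_forall_eq_of_succ_le (Q : ℕ → ℤ) (B : ℤ) (hB : ∀ n, B ≤ Q n)
    (hQ : ∀ n, Q (n + 1) ≤ Q n) : ∃ N, ∀ n, N ≤ n → Q (n + 1) = Q n := by
  let f : ℕ → ℕ := fun n => (Q n - B).toNat
  refine ⟨Function.argmin f, fun n hn => ?_⟩
  have hmin : f (Function.argmin f) ≤ f (n + 1) := Function.argmin_le f (n + 1)
  have hanti : Q n ≤ Q (Function.argmin f) := antitone_nat_of_succ_le hQ hn
  have := hQ n
  have := hB n
  have := hB (n + 1)
  have := hB (Function.argmin f)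
  simp only [f] at hmin hanti this
  omega

/-- Correction term of the potential: `-1` if both trades are accepted and then exactly one. -/
def potentialCorrection (p q p' q' : Bool) : ℤ := if p && q && (p' ^^ q') then -1 else 0

/-- The combinatorial core: an accept/reject array in which consecutive columns differ, which
respects substitutability, and along which indirect utilities `V` obey the revealed preference
bound, eventually has no forbidden fragments. -/
theorem exists_no_fragments (c : ℕ → Fin 2 → Bool) (V : ℕ → ℤ) (hV : ∀ n, 0 ≤ V n)
    (hstep : ∀ n, V (n + 2) ≤ V n +
      ∑ ω, if c (n + 2) ω then ((c (n + 1) ω).toNat - (c n ω).toNat : ℤ) else 0)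
    (hne : ∀ n, c n ≠ c (n + 1))
    (hworse : ∀ n, (∀ ω, c (n + 1) ω ≤ c n ω) →
      ∀ ω, c n ω = c (n + 1) ω → c n ω = true → c (n + 2) ω = true)
    (hbetter : ∀ n, (∀ ω, c n ω ≤ c (n + 1) ω) →
      ∀ ω, c n ω = c (n + 1) ω → c (n + 2) ω = true → c n ω = true) :
    ∃ N : ℕ, ∀ n, N ≤ n → ∀ x y : Fin 2, x ≠ y →
      (¬ (c n x = true ∧ c (n+1) x = true ∧ c (n+2) x = false ∧
          c n y = true ∧ c (n+1) y = false)) ∧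
      (¬ (c n x = false ∧ c (n+1) x = true ∧ c (n+2) x = true ∧
          c n y = false ∧ c (n+1) y = false)) ∧
      (¬ (c n x = true ∧ c (n+1) x = true ∧ c (n+2) x = false ∧
          c (n+1) y = true ∧ c (n+2) y = false)) ∧
      (¬ (c n x = false ∧ c (n+1) x = false ∧ c (n+2) x = true ∧
          c n y = true ∧ c (n+1) y = false ∧ c (n+2) y = true)) ∧
      (¬ (c n x = false ∧ c (n+1) x = true ∧ c (n+2) x = false ∧
          c n y = false ∧ c (n+1) y = false ∧ c (n+2) y = true)) := by
  let g : ℕ → ℤ := fun n => potentialCorrection (c n 0) (c n 1) (c (n + 1) 0) (c (n + 1) 1)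
  let Q : ℕ → ℤ := fun n => V n + V (n + 1) + g n
  have hg : ∀ n, -1 ≤ g n := fun n => by
    simp only [g, potentialCorrection]; split <;> omega
  have hQstep : ∀ n, Q (n + 1) ≤ Q n + g (n + 1) - g n +
      ∑ ω, if c (n + 2) ω then ((c (n + 1) ω).toNat - (c n ω).toNat : ℤ) else 0 := fun n => by
    have := hstep n
    simp only [Q, add_assoc, Nat.reduceAdd]
    omega
  simp only [Fin.forall_fin_two, Fin.sum_univ_two, ne_eq, funext_iff] at *
  have hQ : ∀ n, Q (n + 1) ≤ Q n ∧ (Q (n + 1) = Q n →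
      ¬ (c n 0 ∧ c n 1 ∧ ¬ c (n + 1) 0 ∧ ¬ c (n + 1) 1) ∧
      ¬ ((c n 0 ^^ c n 1) ∧ ¬ c (n + 1) 0 ∧ ¬ c (n + 1) 1 ∧ c (n + 2) 0 ∧ c (n + 2) 1)) :=
    fun n => by
    have h := hQstep n
    have h1 := hne n
    have h2 := hne (n + 1)
    have h3 := hworse n
    have h4 := hbetter n
    simp only [g, potentialCorrection, add_assoc, Nat.reduceAdd] at h h2
    generalize c n 0 = a0, c n 1 = b0, c (n + 1) 0 = a1, c (n + 1) 1 = b1,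
      c (n + 2) 0 = a2, c (n + 2) 1 = b2 at *
    generalize Q n = q, Q (n + 1) = q' at *
    cases a0 <;> cases b0 <;> cases a1 <;> cases b1 <;> cases a2 <;> cases b2 <;>
      simp at h h1 h2 h3 h4 ⊢ <;> omega
  obtain ⟨N, hN⟩ := exists_forall_eq_of_succ_le Q (-1)
    (fun n => by have := hV n; have := hV (n + 1); have := hg n; simp only [Q]; omega)
    (fun n => (hQ n).1)
  refine ⟨N, fun n hn => ?_⟩
  have h0 := ((hQ n).2 (hN n hn)).2
  have h5 := ((hQ (n + 1)).2 (hN (n + 1) (by omega))).1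
  have h1 := hne n
  have h2 := hne (n + 1)
  have h3 := hworse n
  have h4 := hbetter n
  simp only [add_assoc, Nat.reduceAdd] at h2 h5
  generalize c n 0 = a0, c n 1 = b0, c (n + 1) 0 = a1, c (n + 1) 1 = b1,
    c (n + 2) 0 = a2, c (n + 2) 1 = b2 at *
  clear * - h0 h1 h2 h3 h4 h5
  simp only [not_true_eq_false, zero_ne_one, one_ne_zero, not_false_eq_true, forall_const,
    false_implies, true_and, and_true]
  cases a0 <;> cases b0 <;> cases a1 <;> cases b1 <;> cases a2 <;> cases b2 <;>
    first | exact absurd ⟨rfl, rfl⟩ h1 | exact absurd ⟨rfl, rfl⟩ h2 | simp at h0 h3 h4 h5 ⊢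

namespace Market

variable (M : Market Bool (Fin 2)) (s : MState Bool (Fin 2)) (a : Bool)

theorem altAgent_succ (n : ℕ) : altAgent a (n + 1) = !altAgent a n := by
  rcases Nat.mod_two_eq_zero_or_one n with h | h <;> simp [altAgent, h, Nat.add_mod]

theorem altAgent_not (n : ℕ) : altAgent (!a) n = !altAgent a n := by
  unfold altAgent; split <;> rfl

theorem altRun_succ (n : ℕ) :
    M.altRun s a (n + 1) = M.mstep (M.altRun s a n) (altAgent a n) := by
  induction n generalizing s a with
  | zero => rfl
  | succ n ih =>
    rw [altRun, ih, altAgent_not, ← altAgent_succ]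
    rfl

/-- The prices faced by the agent performing the `n`-th best response. -/
def facedPrice (n : ℕ) : Fin 2 → ℤ := M.price (M.altRun s a n).offers (altAgent a n)

theorem col_eq_true_iff (n : ℕ) (ω : Fin 2) :
    M.col s a n ω = true ↔ ω ∈ M.demand (altAgent a n) (M.facedPrice s a n) := by
  simp [col, facedPrice]

variable {M}

theorem seller_eq_not_buyer (ω : Fin 2) : M.seller ω = !M.buyer ω :=
  Bool.eq_not.2 (M.buyer_ne_seller ω).symm

theorem involves (i : Bool) (ω : Fin 2) : M.buyer ω = i ∨ M.seller ω = i := by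
  rw [seller_eq_not_buyer]; cases M.buyer ω <;> cases i <;> simp

theorem chi_not (i : Bool) (ω : Fin 2) : M.chi (!i) ω = -M.chi i ω := by
  simp only [chi, seller_eq_not_buyer]; cases M.buyer ω <;> cases i <;> simp

theorem price_eq (σ : Bool → Fin 2 → ℤ) (i : Bool) (ω : Fin 2) :
    M.price σ i ω = σ (!i) ω := by
  simp only [price, seller_eq_not_buyer]; cases M.buyer ω <;> cases i <;> simp

theorem bestResponse_self (σ : Bool → Fin 2 → ℤ) (i : Bool) (ω : Fin 2) :
    M.bestResponse σ i i ω =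
      if ω ∈ M.demand i (M.price σ i) then M.price σ i ω else M.price σ i ω - M.chi i ω :=
  if_pos ⟨rfl, involves i ω⟩

theorem bestResponse_not (σ : Bool → Fin 2 → ℤ) (i : Bool) (ω : Fin 2) :
    M.bestResponse σ i (!i) ω = σ (!i) ω := by
  simp [bestResponse]

theorem facedPrice_succ (n : ℕ) (ω : Fin 2) :
    M.facedPrice s a (n + 1) ω =
      if M.col s a n ω then M.facedPrice s a n ω
      else M.facedPrice s a n ω - M.chi (altAgent a n) ω := by
  simp only [col_eq_true_iff]
  rw [facedPrice, price_eq, altRun_succ, altAgent_succ, Bool.not_not]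
  exact bestResponse_self _ _ _

theorem facedPrice_add_two (n : ℕ) (ω : Fin 2) :
    M.facedPrice s a (n + 2) ω = M.facedPrice s a n ω -
      M.chi (altAgent a n) ω * ((M.col s a (n + 1) ω).toNat - (M.col s a n ω).toNat : ℤ) := by
  rw [facedPrice_succ, facedPrice_succ, altAgent_succ, chi_not]
  cases M.col s a n ω <;> cases M.col s a (n + 1) ω <;> simp

theorem offers_altRun_self (n : ℕ) (ω : Fin 2) :
    (M.altRun s a (n + 1)).offers (altAgent a (n + 1)) ω = M.facedPrice s a n ω := by
  rw [altRun_succ, altAgent_succ]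
  exact (bestResponse_not _ _ _).trans (price_eq _ _ _).symm

/-- Two equal consecutive columns make the dynamic terminate. -/
theorem col_ne_col_succ (hnt : ¬ M.AltConverges s a) (n : ℕ) :
    M.col s a n ≠ M.col s a (n + 1) := by
  intro h
  refine hnt ⟨n + 2, ?_⟩
  have hoff : ∀ ω, M.bestResponse (M.altRun s a (n + 1)).offers (altAgent a (n + 1))
      (altAgent a (n + 1)) ω = (M.altRun s a (n + 1)).offers (altAgent a (n + 1)) ω := by
    intro ω
    rw [offers_altRun_self]
    have h1 : M.bestResponse (M.altRun s a (n + 1)).offers (altAgent a (n + 1))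
        (altAgent a (n + 1)) ω = M.facedPrice s a (n + 2) ω := by
      rw [facedPrice, price_eq, altRun_succ M s a (n + 1), altAgent_succ a (n + 1), Bool.not_not]
      rfl
    rw [h1, facedPrice_add_two, h]
    simp
  have hmem : altAgent a n ∉ (M.altRun s a (n + 1)).unsat := by
    rw [altRun_succ]
    simp [mstep]
  rw [altRun_succ]
  ext j
  have hj : j = altAgent a (n + 1) ∨ j = altAgent a n := by
    rw [altAgent_succ]; cases j <;> cases altAgent a n <;> simp
  rcases hj with rfl | rfl
  · simp [mstep]
  · simp [mstep, hoff, hmem]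

theorem demand_mono (hFS : M.FSM) (i : Bool) (p p' : Fin 2 → ℤ)
    (hsame : M.buyer 0 = M.buyer 1)
    (h : ∀ ω, M.chi i ω * p' ω ≤ M.chi i ω * p ω) (ω : Fin 2) (hω : p ω = p' ω)
    (hmem : ω ∈ M.demand i p') : ω ∈ M.demand i p := by
  have hb : ∀ ω, M.buyer ω = M.buyer 0 := Fin.forall_fin_two.2 ⟨rfl, hsame.symm⟩
  have hs : ∀ ω, M.seller ω = !M.buyer 0 := fun ω => by rw [seller_eq_not_buyer, hb]
  simp only [chi, hb, hs] at h
  have hF := hFS i p p'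
  simp only [hb, hs] at hF
  by_cases hi : M.buyer 0 = i
  · subst hi
    simp only [if_true, one_mul] at h
    exact (hF.1 ⟨by simp, fun ω _ => h ω⟩).2 ω hmem rfl hω
  · have hi' : (!M.buyer 0) = i := Bool.not_eq.2 hi
    simp only [hi, hi', if_true, if_false, neg_one_mul, neg_le_neg_iff] at h
    exact (hF.2 ⟨by simp [hi], fun ω _ => h ω⟩).2 ω hmem hi' hω

theorem chi_mul_self (i : Bool) (ω : Fin 2) : M.chi i ω * M.chi i ω = 1 := by
  simp only [chi, seller_eq_not_buyer]; cases M.buyer ω <;> cases i <;> simp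

theorem chi_mul_facedPrice_add_two (n : ℕ) (ω : Fin 2) :
    M.chi (altAgent a n) ω * M.facedPrice s a (n + 2) ω =
      M.chi (altAgent a n) ω * M.facedPrice s a n ω -
        ((M.col s a (n + 1) ω).toNat - (M.col s a n ω).toNat : ℤ) := by
  rw [facedPrice_add_two, mul_sub, ← mul_assoc, chi_mul_self, one_mul]

theorem altAgent_add_two (n : ℕ) : altAgent a (n + 2) = altAgent a n := by
  rw [altAgent_succ, altAgent_succ, Bool.not_not]

theorem utility_le_demand (i : Bool) (p : Fin 2 → ℤ) (Ψ : Finset (Fin 2)) :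
    M.utility i Ψ p ≤ M.utility i (M.demand i p) p :=
  M.demand_max i p Ψ fun ω _ => involves i ω

variable (M) in
/-- The indirect utility of the agent performing the `n`-th best response. -/
def indirectUtility (n : ℕ) : ℤ :=
  M.utility (altAgent a n) (M.demand (altAgent a n) (M.facedPrice s a n)) (M.facedPrice s a n)

theorem indirectUtility_nonneg (hN : M.Normalized) (n : ℕ) : 0 ≤ M.indirectUtility s a n := by
  have h := utility_le_demand (M := M) (altAgent a n) (M.facedPrice s a n) ∅
  rwa [utility, hN, Finset.sum_empty, sub_zero] at h

theorem indirectUtility_add_two_le (n : ℕ) :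
    M.indirectUtility s a (n + 2) ≤ M.indirectUtility s a n +
      ∑ ω, if M.col s a (n + 2) ω then
        ((M.col s a (n + 1) ω).toNat - (M.col s a n ω).toNat : ℤ) else 0 := by
  have h := utility_le_demand (M := M) (altAgent a n) (M.facedPrice s a n)
    (M.demand (altAgent a n) (M.facedPrice s a (n + 2)))
  simp only [indirectUtility, col_eq_true_iff, altAgent_add_two]
  refine le_trans (le_of_eq ?_) (add_le_add_left h _)
  rw [utility, utility, Finset.sum_ite_mem, Finset.univ_inter]
  simp only [chi_mul_facedPrice_add_two, Finset.sum_sub_distrib]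
  ring

theorem col_add_two_of_le (hFS : M.FSM) (hsame : M.buyer 0 = M.buyer 1) (n : ℕ)
    (h : ∀ ω, M.col s a (n + 1) ω ≤ M.col s a n ω) (ω : Fin 2)
    (hω : M.col s a n ω = M.col s a (n + 1) ω) (hc : M.col s a n ω = true) :
    M.col s a (n + 2) ω = true := by
  rw [col_eq_true_iff] at hc ⊢
  rw [altAgent_add_two]
  refine demand_mono hFS _ _ _ hsame (fun ω => ?_) ω ?_ hc
  · rw [chi_mul_facedPrice_add_two]
    have := Bool.toNat_le_toNat (h ω)
    omega
  · rw [facedPrice_add_two, hω]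
    simp

theorem col_of_le_of_col_add_two (hFS : M.FSM) (hsame : M.buyer 0 = M.buyer 1) (n : ℕ)
    (h : ∀ ω, M.col s a n ω ≤ M.col s a (n + 1) ω) (ω : Fin 2)
    (hω : M.col s a n ω = M.col s a (n + 1) ω) (hc : M.col s a (n + 2) ω = true) :
    M.col s a n ω = true := by
  rw [col_eq_true_iff, altAgent_add_two] at hc
  rw [col_eq_true_iff]
  refine demand_mono hFS _ _ _ hsame (fun ω => ?_) ω ?_ hc
  · rw [chi_mul_facedPrice_add_two]
    have := Bool.toNat_le_toNat (h ω)
    omega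
  · rw [facedPrice_add_two, hω]
    simp

end Market

/-- In a two-agent FSM with two trades sharing the same buyer and seller,
no cycle of the alternating best response dynamic contains any of the forbidden
three-column fragments (A = `true`, R = `false`; `x`, `y` range over the two possible
row orders, so the swapped-row fragments are covered). -/
theorem cycle_has_no_forbidden_fragments
    (M : Market Bool (Fin 2)) (hN : M.Normalized) (hFS : M.FSM)
    (hsame : M.buyer 0 = M.buyer 1)
    (s : MState Bool (Fin 2)) (a : Bool)
    (hnt : ¬ M.AltConverges s a) :
    ∃ N : ℕ, ∀ n, N ≤ n → ∀ x y : Fin 2, x ≠ y →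
      (¬ (M.col s a n x = true ∧ M.col s a (n+1) x = true ∧ M.col s a (n+2) x = false ∧
          M.col s a n y = true ∧ M.col s a (n+1) y = false)) ∧
      (¬ (M.col s a n x = false ∧ M.col s a (n+1) x = true ∧ M.col s a (n+2) x = true ∧
          M.col s a n y = false ∧ M.col s a (n+1) y = false)) ∧
      (¬ (M.col s a n x = true ∧ M.col s a (n+1) x = true ∧ M.col s a (n+2) x = false ∧
          M.col s a (n+1) y = true ∧ M.col s a (n+2) y = false)) ∧
      (¬ (M.col s a n x = false ∧ M.col s a (n+1) x = false ∧ M.col s a (n+2) x = true ∧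
          M.col s a n y = true ∧ M.col s a (n+1) y = false ∧ M.col s a (n+2) y = true)) ∧
      (¬ (M.col s a n x = false ∧ M.col s a (n+1) x = true ∧ M.col s a (n+2) x = false ∧
          M.col s a n y = false ∧ M.col s a (n+1) y = false ∧ M.col s a (n+2) y = true)) := by
  exact exists_no_fragments (M.col s a) (M.indirectUtility s a)
    (Market.indirectUtility_nonneg s a hN) (Market.indirectUtility_add_two_le s a)
    (Market.col_ne_col_succ s a hnt) (Market.col_add_two_of_le s a hFS hsame)
    (Market.col_of_le_of_col_add_two s a hFS hsame)
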